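/- Let k be a constant and let G be a k-OBDD representing a Boolean function f. Then f can be represented by an unambiguous nondeterministic OBDD of size O(|G|^{2k−1}) that respects the same variable ordering as G and contains exactly one nondeterministic node, namely the source. -/

import Mathlib

namespace BDDPaper

/-- Labels of nodes in a (nondeterministic) binary decision diagram over
variables indexed by `Fin n`. -/
inductive BLabel (n : ℕ) where
  | decision (i : Fin n)
  | orNode
  | sink (b : Bool)
  deriving DecidableEq

/-- A nondeterministic binary decision diagram (with nodes listed in a
topological order, i.e. all edges lead to nodes of larger index, which
encodes acyclicity). Decision nodes have the two successors `succ0`/`succ1`;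
`∨`-nodes have the (unlabeled) successors `orSucc`. -/
structure NBDD (n : ℕ) where
  size : ℕ
  label : Fin size → BLabel n
  succ0 : Fin size → Fin size
  succ1 : Fin size → Fin size
  orSucc : Fin size → Finset (Fin size)
  source : Fin size
  succ0_lt : ∀ u i, label u = .decision i → u < succ0 u
  succ1_lt : ∀ u i, label u = .decision i → u < succ1 u
  orSucc_lt : ∀ u v, label u = .orNode → v ∈ orSucc u → u < v

namespace NBDD

variable {n : ℕ} (G : NBDD n)

/-- The edge relation of the diagram. -/
def Edge (u v : Fin G.size) : Prop :=
  (∃ i, G.label u = .decision i ∧ (v = G.succ0 u ∨ v = G.succ1 u)) ∨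
  (G.label u = .orNode ∧ v ∈ G.orSucc u)

/-- The edges activated by an input `b`. -/
def Active (b : Fin n → Bool) (u v : Fin G.size) : Prop :=
  (∃ i, G.label u = .decision i ∧ v = (if b i then G.succ1 u else G.succ0 u)) ∨
  (G.label u = .orNode ∧ v ∈ G.orSucc u)

/-- `p` is a path of edges activated by `b` starting at node `s`. -/
def IsPathFrom (b : Fin n → Bool) (s : Fin G.size) (p : List (Fin G.size)) : Prop :=
  p.head? = some s ∧ List.Chain' (G.Active b) p

/-- The path `p` ends in the 1-sink. -/
def EndsAccepting (p : List (Fin G.size)) : Prop :=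
  ∃ v, p.getLast? = some v ∧ G.label v = .sink true

/-- There is a path of edges activated by `b` from `s` to the 1-sink. -/
def AcceptsFrom (b : Fin n → Bool) (s : Fin G.size) : Prop :=
  ∃ p, G.IsPathFrom b s p ∧ G.EndsAccepting p

/-- `p` is an accepting path for the input `b`. -/
def AcceptingPath (b : Fin n → Bool) (p : List (Fin G.size)) : Prop :=
  G.IsPathFrom b G.source p ∧ G.EndsAccepting p

/-- The diagram accepts the input `b`. -/
def Accepts (b : Fin n → Bool) : Prop := ∃ p, G.AcceptingPath b p

/-- The diagram represents the Boolean function `f`. -/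
def Represents (f : (Fin n → Bool) → Bool) : Prop :=
  ∀ b, f b = true ↔ G.Accepts b

/-- The diagram is unambiguous nondeterministic: every input has at most one
accepting path. -/
def Unambiguous : Prop :=
  ∀ b p q, G.AcceptingPath b p → G.AcceptingPath b q → p = q

/-- The diagram is deterministic, i.e. an ordinary BDD: it has no `∨`-nodes. -/
def Deterministic : Prop := ∀ u, G.label u ≠ .orNode

/-- The diagram respects the variable ordering given by the strict order `r`:
along every directed path the labels of the decision nodes form a subsequence
of the ordering, i.e. they strictly increase w.r.t. `r`. -/
def IsOBDDRel (r : Fin n → Fin n → Prop) : Prop :=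
  ∀ u v i j, Relation.TransGen G.Edge u v →
    G.label u = .decision i → G.label v = .decision j → r i j

/-- The diagram is ordered w.r.t. the variable ordering `π` (position `p` of the
ordering holds the variable `π p`). -/
def IsOBDD (π : Equiv.Perm (Fin n)) : Prop :=
  G.IsOBDDRel fun i j => π.symm i < π.symm j

/-- Free BDD condition: on every directed path every variable is tested at most
once. -/
def IsFBDD : Prop :=
  ∀ u v i j, Relation.TransGen G.Edge u v →
    G.label u = .decision i → G.label v = .decision j → i ≠ j

/-- `u` is an internal node (not a sink). -/
def IsInternal (u : Fin G.size) : Prop := ∀ c : Bool, G.label u ≠ .sink c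

/-- The set of variables appearing (as decision-node labels) in the subgraph
rooted at `u`. -/
def varsAt (u : Fin G.size) : Set (Fin n) :=
  {i | ∃ v, Relation.ReflTransGen G.Edge u v ∧ G.label v = .decision i}

end NBDD

end BDDPaper
namespace BDDPaper

namespace NBDD

variable {n : ℕ} (G : NBDD n)

/-- `G` is a `k`-OBDD w.r.t. the variable ordering `π`: a deterministic BDD
that can be partitioned into `k` layers such that edges never lead to earlier
layers (edges leaving a layer reach later layers or sinks) and, within each
layer, the labels of the decision nodes along every directed path form a
subsequence of the common variable ordering `π`. -/
def IsKOBDD (k : ℕ) (π : Equiv.Perm (Fin n)) : Prop :=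
  G.Deterministic ∧ ∃ layer : Fin G.size → ℕ,
    (∀ u, layer u < k) ∧
    (∀ u v, G.Edge u v → (∀ c : Bool, G.label v ≠ .sink c) → layer u ≤ layer v) ∧
    (∀ u v i j, Relation.TransGen G.Edge u v → layer u = layer v →
        G.label u = .decision i → G.label v = .decision j → π.symm i < π.symm j)

end NBDD

end BDDPaper
namespace BDDPaper

namespace NBDD

variable {n : ℕ} (G : NBDD n)

theorem acceptsFrom_iff (b : Fin n → Bool) (u : Fin G.size) :
    G.AcceptsFrom b u ↔
      G.label u = .sink true ∨ ∃ v, G.Active b u v ∧ G.AcceptsFrom b v := by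
  constructor
  · rintro ⟨p, ⟨hhead, hchain⟩, w, hlast, hw⟩
    match p, hhead, hchain, hlast with
    | [x], hhead, hchain, hlast =>
      simp only [List.head?_cons, Option.some.injEq, List.getLast?_singleton] at hhead hlast
      subst hhead; subst hlast
      exact Or.inl hw
    | x :: y :: p, hhead, hchain, hlast =>
      simp only [List.head?_cons, Option.some.injEq] at hhead
      subst hhead
      have hc := List.isChain_cons_cons.1 hchain
      refine Or.inr ⟨y, hc.1, y :: p, ⟨rfl, hc.2⟩, w, ?_, hw⟩
      rwa [List.getLast?_cons_cons] at hlast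
  · rintro (h | ⟨v, hv, p, ⟨hhead, hchain⟩, w, hlast, hw⟩)
    · exact ⟨[u], ⟨rfl, List.isChain_singleton u⟩, u, rfl, h⟩
    · match p, hhead, hchain, hlast with
      | y :: p, hhead, hchain, hlast =>
        simp only [List.head?_cons, Option.some.injEq] at hhead
        subst hhead
        refine ⟨u :: y :: p, ⟨rfl, List.isChain_cons_cons.2 ⟨hv, hchain⟩⟩, w, ?_, hw⟩
        rwa [List.getLast?_cons_cons]

theorem acceptsFrom_sink_iff (b : Fin n → Bool) {u : Fin G.size} {c : Bool}
    (hu : G.label u = .sink c) : G.AcceptsFrom b u ↔ c = true := by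
  rw [acceptsFrom_iff]
  simp [Active, hu]

theorem acceptsFrom_decision_iff (b : Fin n → Bool) {u : Fin G.size} {i : Fin n}
    (hu : G.label u = .decision i) :
    G.AcceptsFrom b u ↔ G.AcceptsFrom b (if b i then G.succ1 u else G.succ0 u) := by
  rw [acceptsFrom_iff]
  simp [Active, hu]

theorem acceptsFrom_orNode_iff (b : Fin n → Bool) {u : Fin G.size}
    (hu : G.label u = .orNode) :
    G.AcceptsFrom b u ↔ ∃ v ∈ G.orSucc u, G.AcceptsFrom b v := by
  rw [acceptsFrom_iff]
  simp [Active, hu]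

/-- If at every node at most one activated edge can be continued to the 1-sink, then
accepting paths are unique. -/
theorem accepting_path_unique {b : Fin n → Bool}
    (h : ∀ u v w, G.Active b u v → G.Active b u w →
      G.AcceptsFrom b v → G.AcceptsFrom b w → v = w)
    (p q : List (Fin G.size)) (s : Fin G.size)
    (hp : G.IsPathFrom b s p) (hp' : G.EndsAccepting p)
    (hq : G.IsPathFrom b s q) (hq' : G.EndsAccepting q) : p = q := by
  have not_active : ∀ u v, G.label u = .sink true → ¬ G.Active b u v := by
    intro u v hu
    simp [Active, hu]
  induction p generalizing s q with
  | nil => simp [IsPathFrom] at hp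
  | cons x p ih =>
    obtain ⟨hx, hpc⟩ := hp
    simp only [List.head?_cons, Option.some.injEq] at hx
    subst hx
    match q, hq, hq' with
    | [], hq, _ => simp [IsPathFrom] at hq
    | y :: q, ⟨hy, hqc⟩, hq' =>
      simp only [List.head?_cons, Option.some.injEq] at hy
      subst hy
      match p, q, hpc, hp', hqc, hq', ih with
      | [], [], _, _, _, _, _ => rfl
      | [], z :: q, _, ⟨w, hw, hw'⟩, hqc, _, _ =>
        simp only [List.getLast?_singleton, Option.some.injEq] at hw
        subst hw
        exact absurd (List.isChain_cons_cons.1 hqc).1 (not_active _ _ hw')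
      | z :: p, [], hpc, _, _, ⟨w, hw, hw'⟩, _ =>
        simp only [List.getLast?_singleton, Option.some.injEq] at hw
        subst hw
        exact absurd (List.isChain_cons_cons.1 hpc).1 (not_active _ _ hw')
      | z :: p, z' :: q, hpc, ⟨w, hw, hw'⟩, hqc, ⟨v, hv, hv'⟩, ih =>
        rw [List.getLast?_cons_cons] at hw hv
        have hp1 := List.isChain_cons_cons.1 hpc
        have hq1 := List.isChain_cons_cons.1 hqc
        have hz : z = z' := h y z z' hp1.1 hq1.1
          ⟨z :: p, ⟨rfl, hp1.2⟩, w, hw, hw'⟩ ⟨z' :: q, ⟨rfl, hq1.2⟩, v, hv, hv'⟩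
        subst hz
        rw [ih (z :: q) z ⟨rfl, hp1.2⟩ ⟨w, hw, hw'⟩ ⟨rfl, hq1.2⟩ ⟨v, hv, hv'⟩]

/-- A diagram on an arbitrary finite type of nodes whose edges increase a rank function can be
topologically sorted. -/
theorem exists_of_rank {σ : Type*} [Fintype σ] (r : σ → ℕ) (label : σ → BLabel n)
    (succ : Bool → σ → σ) (orSucc : σ → Finset σ) (source : σ)
    (hsucc : ∀ c s i, label s = .decision i → r s < r (succ c s))
    (hor : ∀ s t, label s = .orNode → t ∈ orSucc s → r s < r t) :
    ∃ (F : NBDD n) (e : σ ≃ Fin F.size), F.size = Fintype.card σ ∧ F.source = e source ∧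
      (∀ s, F.label (e s) = label s) ∧ (∀ s, F.succ0 (e s) = e (succ false s)) ∧
      (∀ s, F.succ1 (e s) = e (succ true s)) ∧
      (∀ s t, e t ∈ F.orSucc (e s) ↔ t ∈ orSucc s) := by
  classical
  let key : σ → ℕ ×ₗ Fin (Fintype.card σ) := fun s => toLex (r s, Fintype.equivFin σ s)
  have key_inj : Function.Injective key := by
    intro s t hst
    have := congrArg (fun x => (ofLex x).2) hst
    exact (Fintype.equivFin σ).injective this
  let : LinearOrder σ := LinearOrder.lift' key key_inj
  have lt_of_rank : ∀ s t : σ, r s < r t → s < t := by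
    intro s t hst
    change key s < key t
    exact Prod.Lex.toLex_lt_toLex.2 (Or.inl hst)
  let e : Fin (Fintype.card σ) ≃o σ := Fintype.orderIsoFinOfCardEq σ rfl
  have key_lt : ∀ (u : Fin (Fintype.card σ)) (t : σ), r (e u) < r t → u < e.symm t := by
    intro u t hut
    exact e.lt_symm_apply.2 (lt_of_rank _ _ hut)
  refine ⟨{ size := Fintype.card σ
            label := fun u => label (e u)
            succ0 := fun u => e.symm (succ false (e u))
            succ1 := fun u => e.symm (succ true (e u))
            orSucc := fun u => (orSucc (e u)).map e.symm.toEquiv.toEmbedding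
            source := e.symm source
            succ0_lt := fun u i hu => key_lt _ _ (hsucc _ _ i hu)
            succ1_lt := fun u i hu => key_lt _ _ (hsucc _ _ i hu)
            orSucc_lt := ?_ }, e.symm.toEquiv, rfl, rfl, ?_, ?_, ?_, ?_⟩
  · intro u v hu hv
    obtain ⟨t, ht, rfl⟩ := Finset.mem_map.1 hv
    exact key_lt _ _ (hor _ _ hu ht)
  all_goals simp

/-- Follow the computation of `G` on `b` from `u` as long as it stays at decision nodes of
layer `j`. -/
noncomputable def layerRun (layer : Fin G.size → ℕ) (b : Fin n → Bool) (j : ℕ)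
    (u : Fin G.size) : Fin G.size :=
  open Classical in
  if h : ∃ i, G.label u = .decision i ∧ layer u = j then
    layerRun layer b j (if b h.choose then G.succ1 u else G.succ0 u)
  else u
termination_by G.size - u.val
decreasing_by
  have h0 := G.succ0_lt u _ h.choose_spec.1
  have h1 := G.succ1_lt u _ h.choose_spec.1
  rw [Fin.lt_def] at h0 h1
  split <;> omega

variable (layer : Fin G.size → ℕ)

theorem layerRun_of_decision (b : Fin n → Bool) {j : ℕ} {u : Fin G.size} {i : Fin n}
    (hu : G.label u = .decision i) (hj : layer u = j) :
    G.layerRun layer b j u =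
      G.layerRun layer b j (if b i then G.succ1 u else G.succ0 u) := by
  have h : ∃ i, G.label u = .decision i ∧ layer u = j := ⟨i, hu, hj⟩
  have hi : h.choose = i := by
    exact (BLabel.decision.inj (hu.symm.trans h.choose_spec.1)).symm
  conv_lhs => rw [layerRun, dif_pos h, hi]

theorem layerRun_of_not (b : Fin n → Bool) {j : ℕ} {u : Fin G.size}
    (h : ¬ ∃ i, G.label u = .decision i ∧ layer u = j) :
    G.layerRun layer b j u = u := by
  rw [layerRun, dif_neg h]

theorem acceptsFrom_layerRun_iff (b : Fin n → Bool) (j : ℕ) (u : Fin G.size) :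
    G.AcceptsFrom b (G.layerRun layer b j u) ↔ G.AcceptsFrom b u := by
  by_cases h : ∃ i, G.label u = .decision i ∧ layer u = j
  · obtain ⟨i, hu, hj⟩ := h
    have h0 := G.succ0_lt u _ hu
    have h1 := G.succ1_lt u _ hu
    rw [Fin.lt_def] at h0 h1
    rw [G.layerRun_of_decision layer b hu hj, G.acceptsFrom_decision_iff b hu]
    exact acceptsFrom_layerRun_iff b j _
  · rw [G.layerRun_of_not layer b h]
termination_by G.size - u.val
decreasing_by split <;> omega

theorem layerRun_spec (hdet : G.Deterministic)
    (hmono : ∀ u v, G.Edge u v → (∀ c : Bool, G.label v ≠ .sink c) → layer u ≤ layer v)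
    (b : Fin n → Bool) (j : ℕ) (u : Fin G.size)
    (h : (∀ c : Bool, G.label u ≠ .sink c) → j ≤ layer u) :
    (∀ c : Bool, G.label (G.layerRun layer b j u) ≠ .sink c) →
      j + 1 ≤ layer (G.layerRun layer b j u) := by
  by_cases hd : ∃ i, G.label u = .decision i ∧ layer u = j
  · obtain ⟨i, hu, hj⟩ := hd
    have h0 := G.succ0_lt u _ hu
    have h1 := G.succ1_lt u _ hu
    rw [Fin.lt_def] at h0 h1
    rw [G.layerRun_of_decision layer b hu hj]
    refine layerRun_spec hdet hmono b j _ fun hs => hj ▸ hmono u _ (Or.inl ⟨i, hu, ?_⟩) hs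
    split <;> simp
  · rw [G.layerRun_of_not layer b hd]
    intro hs
    have hj := h hs
    rcases hl : G.label u with i | _ | c
    · have : layer u ≠ j := fun hj => hd ⟨i, hl, hj⟩
      omega
    · exact absurd hl (hdet u)
    · exact absurd hl (hs c)
termination_by G.size - u.val
decreasing_by split <;> omega

/-- The node at which the computation of `G` on `b` enters the layers from `j` on. -/
noncomputable def layerEntry (b : Fin n → Bool) : ℕ → Fin G.size
  | 0 => G.source
  | j + 1 => G.layerRun layer b j (layerEntry b j)

theorem acceptsFrom_layerEntry_iff (b : Fin n → Bool) (j : ℕ) :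
    G.AcceptsFrom b (G.layerEntry layer b j) ↔ G.AcceptsFrom b G.source := by
  induction j with
  | zero => rfl
  | succ j ih => rw [layerEntry, acceptsFrom_layerRun_iff, ih]

theorem le_layer_layerEntry (hdet : G.Deterministic)
    (hmono : ∀ u v, G.Edge u v → (∀ c : Bool, G.label v ≠ .sink c) → layer u ≤ layer v)
    (b : Fin n → Bool) (j : ℕ) :
    (∀ c : Bool, G.label (G.layerEntry layer b j) ≠ .sink c) →
      j ≤ layer (G.layerEntry layer b j) := by
  induction j with
  | zero => simp
  | succ j ih => exact G.layerRun_spec layer hdet hmono b j _ ih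

theorem accepts_iff_layerEntry {k : ℕ} (hdet : G.Deterministic) (hk : ∀ u, layer u < k)
    (hmono : ∀ u v, G.Edge u v → (∀ c : Bool, G.label v ≠ .sink c) → layer u ≤ layer v)
    (b : Fin n → Bool) :
    G.Accepts b ↔ G.label (G.layerEntry layer b k) = .sink true := by
  have hsink : ∃ c : Bool, G.label (G.layerEntry layer b k) = .sink c := by
    by_contra! hs
    exact absurd (G.le_layer_layerEntry layer hdet hmono b k hs) (hk _).not_ge
  obtain ⟨c, hc⟩ := hsink
  change G.AcceptsFrom b G.source ↔ _
  rw [← G.acceptsFrom_layerEntry_iff layer b k, G.acceptsFrom_sink_iff b hc, hc]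
  simp

section Product

variable {m : ℕ}

/-- Some token of `t` waits at a decision node of its own layer testing variable `i`. -/
def Tests (t : Fin (m + 1) → Fin G.size) (i : Fin n) : Prop :=
  ∃ j, G.label (t j) = .decision i ∧ layer (t j) = j

/-- `i` is the first variable in the ordering `π` tested by a token of `t`. -/
def TestsFirst (π : Equiv.Perm (Fin n)) (t : Fin (m + 1) → Fin G.size) (i : Fin n) : Prop :=
  G.Tests layer t i ∧ ∀ i', G.Tests layer t i' → π.symm i ≤ π.symm i'

/-- Every token has arrived at the guessed entry of the next layer, the last one at a
1-sink. -/
def Arrived (g : Fin m → Fin G.size) (t : Fin (m + 1) → Fin G.size) : Prop :=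
  (∀ j : Fin m, t j.castSucc = g j) ∧ G.label (t (Fin.last m)) = .sink true

open Classical in
/-- Move the tokens testing variable `i` along their `c`-edges. -/
noncomputable def advance (c : Bool) (i : Fin n) (t : Fin (m + 1) → Fin G.size) :
    Fin (m + 1) → Fin G.size := fun j =>
  if G.label (t j) = .decision i ∧ layer (t j) = j then
    if c then G.succ1 (t j) else G.succ0 (t j)
  else t j

open Classical in
/-- Label of a node of the layer product: `none` is the source, and `some (g, t)` has guessed
the layer entries `g` and reached the tokens `t`. -/
noncomputable def productLabel (π : Equiv.Perm (Fin n)) :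
    Option ((Fin m → Fin G.size) × (Fin (m + 1) → Fin G.size)) → BLabel n
  | none => .orNode
  | some (g, t) =>
    if h : ∃ i, G.TestsFirst layer π t i then .decision h.choose
    else .sink (decide (G.Arrived g t))

/-- Successor of a node of the layer product. -/
noncomputable def productSucc (π : Equiv.Perm (Fin n)) (c : Bool)
    (s : Option ((Fin m → Fin G.size) × (Fin (m + 1) → Fin G.size))) :
    Option ((Fin m → Fin G.size) × (Fin (m + 1) → Fin G.size)) :=
  match G.productLabel layer π s with
  | .decision i => s.map fun x => (x.1, G.advance layer c i x.2)
  | _ => s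

/-- Rank along which the layer product is topologically sorted. -/
def productRank : Option ((Fin m → Fin G.size) × (Fin (m + 1) → Fin G.size)) → ℕ
  | none => 0
  | some (_, t) => 1 + ∑ j, (t j : ℕ)

variable {G layer}

theorem productLabel_eq_decision {π : Equiv.Perm (Fin n)} {g : Fin m → Fin G.size}
    {t : Fin (m + 1) → Fin G.size} {i : Fin n}
    (h : G.productLabel layer π (some (g, t)) = .decision i) : G.TestsFirst layer π t i := by
  rw [productLabel] at h
  split at h
  · rename_i hex
    exact BLabel.decision.inj h ▸ hex.choose_spec
  · cases h

theorem productLabel_ne_orNode {π : Equiv.Perm (Fin n)}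
    (x : (Fin m → Fin G.size) × (Fin (m + 1) → Fin G.size)) :
    G.productLabel layer π (some x) ≠ .orNode := by
  obtain ⟨g, t⟩ := x
  rw [productLabel]
  split <;> simp

theorem not_tests_of_sink {π : Equiv.Perm (Fin n)} {g : Fin m → Fin G.size}
    {t : Fin (m + 1) → Fin G.size} {c : Bool}
    (h : G.productLabel layer π (some (g, t)) = .sink c) :
    (∀ i, ¬ G.Tests layer t i) ∧ (c = true ↔ G.Arrived g t) := by
  classical
  rw [productLabel] at h
  split at h
  · cases h
  · rename_i hex
    refine ⟨fun i hi => hex ?_, ?_⟩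
    · obtain ⟨i₀, h₀, hmin⟩ := Finset.exists_min_image
        (Finset.univ.filter fun i => G.Tests layer t i) (fun i => π.symm i) ⟨i, by simpa using hi⟩
      exact ⟨i₀, (Finset.mem_filter.1 h₀).2, fun i' hi' => hmin i' (by simpa using hi')⟩
    · rw [← BLabel.sink.inj h]
      simp

theorem productSucc_of_decision {π : Equiv.Perm (Fin n)} {g : Fin m → Fin G.size}
    {t : Fin (m + 1) → Fin G.size} {i : Fin n}
    (h : G.productLabel layer π (some (g, t)) = .decision i) (c : Bool) :
    G.productSucc layer π c (some (g, t)) = some (g, G.advance layer c i t) := by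
  simp [productSucc, h]

theorem le_advance (c : Bool) (i : Fin n) (t : Fin (m + 1) → Fin G.size) (j : Fin (m + 1)) :
    t j ≤ G.advance layer c i t j := by
  rw [advance]
  split
  · rename_i h
    have h0 := G.succ0_lt _ _ h.1
    have h1 := G.succ1_lt _ _ h.1
    split
    exacts [h1.le, h0.le]
  · exact le_rfl

theorem productRank_lt_succ (π : Equiv.Perm (Fin n)) (c : Bool)
    (s : Option ((Fin m → Fin G.size) × (Fin (m + 1) → Fin G.size))) (i : Fin n)
    (h : G.productLabel layer π s = .decision i) :
    G.productRank s < G.productRank (G.productSucc layer π c s) := by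
  match s, h with
  | none, h => simp [productLabel] at h
  | some (g, t), h =>
    rw [productSucc_of_decision h]
    obtain ⟨⟨j, hj⟩, -⟩ := productLabel_eq_decision h
    refine Nat.add_lt_add_left (Finset.sum_lt_sum (fun j _ => le_advance c i t j)
      ⟨j, Finset.mem_univ j, ?_⟩) 1
    rw [advance, if_pos hj, ← Fin.lt_def]
    split
    exacts [G.succ1_lt _ _ hj.1, G.succ0_lt _ _ hj.1]

/-- After the first tested variable has been read, only later variables are tested. -/
theorem lt_of_tests_advance {π : Equiv.Perm (Fin n)}
    (hord : ∀ u v i j, Relation.TransGen G.Edge u v → layer u = layer v →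
      G.label u = .decision i → G.label v = .decision j → π.symm i < π.symm j)
    {t : Fin (m + 1) → Fin G.size} {c : Bool} {i i' : Fin n}
    (hi : G.TestsFirst layer π t i) (hi' : G.Tests layer (G.advance layer c i t) i') :
    π.symm i < π.symm i' := by
  obtain ⟨j, hl, hj⟩ := hi'
  rw [advance] at hl hj
  by_cases hm : G.label (t j) = .decision i ∧ layer (t j) = j
  · rw [if_pos hm] at hl hj
    refine hord _ _ i i' (.single (Or.inl ⟨i, hm.1, ?_⟩)) (hm.2.trans hj.symm) hm.1 hl
    cases c <;> simp
  · rw [if_neg hm] at hl hj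
    refine lt_of_le_of_ne (hi.2 i' ⟨j, hl, hj⟩) fun heq => hm ⟨?_, hj⟩
    rw [hl, π.symm.injective heq]

theorem layerRun_advance (b : Fin n → Bool) (i : Fin n) (t : Fin (m + 1) → Fin G.size)
    (j : Fin (m + 1)) :
    G.layerRun layer b j (G.advance layer (b i) i t j) = G.layerRun layer b j (t j) := by
  rw [advance]
  split
  · rename_i h
    rw [← G.layerRun_of_decision layer b h.1 h.2]
  · rfl

/-- Guesses that are confirmed by the runs in all layers are the true layer entries. -/
theorem arrived_layerRun_iff (b : Fin n → Bool) (g : Fin m → Fin G.size) :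
    G.Arrived g (fun j : Fin (m + 1) =>
        G.layerRun layer b j ((Fin.cons G.source g : Fin (m + 1) → Fin G.size) j)) ↔
      (g = fun j : Fin m => G.layerEntry layer b (j + 1)) ∧
        G.label (G.layerEntry layer b (m + 1)) = .sink true := by
  have key : (∀ j : Fin (m + 1),
      (Fin.cons G.source g : Fin (m + 1) → Fin G.size) j = G.layerEntry layer b j) →
      (G.Arrived g (fun j : Fin (m + 1) =>
        G.layerRun layer b j ((Fin.cons G.source g : Fin (m + 1) → Fin G.size) j)) ↔
      (g = fun j : Fin m => G.layerEntry layer b (j + 1)) ∧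
        G.label (G.layerEntry layer b (m + 1)) = .sink true) := by
    intro h
    simp only [Arrived, h, funext_iff]
    simp only [Fin.val_castSucc, Fin.val_last, layerEntry, eq_comm]
  constructor
  · intro hA
    refine (key fun j => ?_).1 hA
    induction j using Fin.induction with
    | zero => rfl
    | succ j ih =>
      rw [Fin.cons_succ, ← hA.1 j]
      dsimp only
      rw [ih]
      rfl
  · intro hA
    refine (key fun j => ?_).2 hA
    refine Fin.cases rfl (fun j => ?_) j
    rw [Fin.cons_succ, hA.1]
    rfl

end Product

end NBDD

open NBDD in
/-- Let `k` be a constant and let `G` be a `k`-OBDD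
representing a Boolean function `f`. Then `f` can be represented by an
unambiguous nondeterministic OBDD of size `O(|G|^{2k-1})` that respects the
same variable ordering as `G` and contains exactly one nondeterministic node,
namely the source. -/
theorem statement18 (k : ℕ) (hk : 0 < k) :
    ∃ c : ℕ, ∀ (n : ℕ) (G : NBDD n) (π : Equiv.Perm (Fin n))
      (f : (Fin n → Bool) → Bool),
      G.IsKOBDD k π → G.Represents f →
      ∃ F : NBDD n, F.Unambiguous ∧ F.IsOBDD π ∧ F.Represents f ∧
        F.label F.source = .orNode ∧
        (∀ u, F.label u = .orNode → u = F.source) ∧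
        F.size ≤ c * G.size ^ (2 * k - 1) := by
  classical
  refine ⟨2, fun n G π f ⟨hdet, layer, hlayer, hmono, hord⟩ hf => ?_⟩
  obtain ⟨m, rfl⟩ : ∃ m, k = m + 1 := ⟨k - 1, by omega⟩
  let start : (Fin m → Fin G.size) → (Fin m → Fin G.size) × (Fin (m + 1) → Fin G.size) :=
    fun g => (g, Fin.cons G.source g)
  obtain ⟨F, e, hsize, hsource, hlabel, hsucc0, hsucc1, hor⟩ :=
    NBDD.exists_of_rank (productRank G (m := m)) (G.productLabel layer π)
      (G.productSucc layer π) (fun _ => Finset.univ.image fun g => some (start g)) none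
      (productRank_lt_succ π) (by
        rintro (_ | x) t hs ht
        · obtain ⟨g, -, rfl⟩ := Finset.mem_image.1 ht
          simp [productRank, start]
        · exact absurd hs (productLabel_ne_orNode x))
  have hsourceLabel : F.label F.source = .orNode := by rw [hsource, hlabel]; rfl
  have horOnly : ∀ u, F.label u = .orNode → u = F.source := by
    intro u hu
    obtain ⟨_ | x, rfl⟩ := e.surjective u
    · exact hsource.symm
    · rw [hlabel] at hu
      exact absurd hu (productLabel_ne_orNode x)
  have hsucc : ∀ {g t i} (c : Bool), F.label (e (some (g, t))) = .decision i →
      (if c then F.succ1 (e (some (g, t))) else F.succ0 (e (some (g, t)))) =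
        e (some (g, G.advance layer c i t)) := by
    intro g t i c h
    rw [hlabel] at h
    cases c <;> simp [hsucc0, hsucc1, productSucc_of_decision h]
  have accepts_node : ∀ b N g t, F.size - (e (some (g, t))).val = N →
      (F.AcceptsFrom b (e (some (g, t))) ↔
        G.Arrived g fun j : Fin (m + 1) => G.layerRun layer b j (t j)) := by
    intro b N
    induction N using Nat.strong_induction_on with
    | _ N ih =>
      intro g t hN
      rcases hl : F.label (e (some (g, t))) with i | _ | c
      · rw [F.acceptsFrom_decision_iff b hl, hsucc (b i) hl, ih _ ?_ g _ rfl]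
        · simp only [layerRun_advance]
        · have h0 := F.succ0_lt _ _ hl
          have h1 := F.succ1_lt _ _ hl
          rw [Fin.lt_def] at h0 h1
          have h2 := hsucc (b i) hl
          rw [← h2, ← hN]
          split <;> omega
      · rw [hlabel] at hl
        exact absurd hl (productLabel_ne_orNode _)
      · rw [F.acceptsFrom_sink_iff b hl]
        rw [hlabel] at hl
        obtain ⟨hno, hc⟩ := not_tests_of_sink hl
        rw [hc]
        have : (fun j : Fin (m + 1) => G.layerRun layer b j (t j)) = t := by
          funext j
          exact G.layerRun_of_not layer b fun ⟨i, hi⟩ => hno i ⟨j, hi⟩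
        rw [this]
  have accepts_start : ∀ b g, F.AcceptsFrom b (e (some (start g))) ↔
      (g = fun j : Fin m => G.layerEntry layer b (j + 1)) ∧
        G.label (G.layerEntry layer b (m + 1)) = .sink true := fun b g =>
    (accepts_node b _ g _ rfl).trans (arrived_layerRun_iff b g)
  have mem_source : ∀ v, v ∈ F.orSucc F.source ↔ ∃ g, v = e (some (start g)) := by
    intro v
    obtain ⟨s, rfl⟩ := e.surjective v
    rw [hsource, hor]
    simp [eq_comm]
  refine ⟨F, ?_, ?_, ?_, hsourceLabel, horOnly, ?_⟩
  · intro b p q hp hq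
    refine F.accepting_path_unique ?_ p q F.source hp.1 hp.2 hq.1 hq.2
    rintro u v w (⟨i, hi, rfl⟩ | ⟨hu, hv⟩) (⟨i', hi', rfl⟩ | ⟨hu', hw⟩) hav haw
    · rw [hi] at hi'
      cases hi'
      rfl
    · rw [hi] at hu'
      cases hu'
    · rw [hu] at hi'
      cases hi'
    · obtain rfl := horOnly u hu
      obtain ⟨g, rfl⟩ := (mem_source v).1 hv
      obtain ⟨g', rfl⟩ := (mem_source w).1 hw
      rw [((accepts_start b g).1 hav).1, ((accepts_start b g').1 haw).1]
  · have edge_tests : ∀ {u v i j}, F.Edge u v → F.label u = .decision i →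
        F.label v = .decision j → π.symm i < π.symm j := by
      rintro u v i j (⟨i', hi', hv⟩ | ⟨hu, -⟩) hi hj
      · rw [hi] at hi'
        cases hi'
        obtain ⟨_ | ⟨g, t⟩, rfl⟩ := e.surjective u
        · rw [hlabel] at hi
          cases hi
        · obtain ⟨c, rfl⟩ : ∃ c : Bool, v = e (some (g, G.advance layer c i t)) := by
            rcases hv with rfl | rfl
            · exact ⟨false, by simpa using hsucc false hi⟩
            · exact ⟨true, by simpa using hsucc true hi⟩
          rw [hlabel] at hi hj
          exact lt_of_tests_advance hord (productLabel_eq_decision hi)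
            (productLabel_eq_decision hj).1
      · rw [hi] at hu
        cases hu
    intro u v i j huv hi hj
    induction huv using Relation.TransGen.head_induction_on generalizing i with
    | single h => exact edge_tests h hi hj
    | @head u w huw hwv ih =>
      rcases hw : F.label w with i' | _ | c
      · exact (edge_tests huw hi hw).trans (ih i' hw)
      · exfalso
        obtain rfl := horOnly w hw
        rcases huw with ⟨i', hi', hw'⟩ | ⟨hu, -⟩
        · obtain ⟨_ | ⟨g, t⟩, rfl⟩ := e.surjective u
          · rw [hlabel] at hi
            cases hi
          · have h0 := hsucc false hi
            have h1 := hsucc true hi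
            simp only [if_true, Bool.false_eq_true, if_false] at h0 h1
            rw [h0, h1, hsource] at hw'
            simp at hw'
        · rw [hi] at hu
          cases hu
      · exfalso
        obtain ⟨x, hx, -⟩ := (Relation.TransGen.head'_iff).1 hwv
        simp [Edge, hw] at hx
  · intro b
    rw [hf b, G.accepts_iff_layerEntry layer hdet hlayer hmono b]
    change _ ↔ F.AcceptsFrom b F.source
    rw [F.acceptsFrom_orNode_iff b hsourceLabel]
    constructor
    · intro h
      exact ⟨_, (mem_source _).2 ⟨_, rfl⟩, (accepts_start b _).2 ⟨rfl, h⟩⟩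
    · rintro ⟨v, hv, hacc⟩
      obtain ⟨g, rfl⟩ := (mem_source v).1 hv
      exact ((accepts_start b g).1 hacc).2
  · have hpos : 0 < G.size := G.source.pos
    have : 0 < G.size ^ (2 * (m + 1) - 1) := Nat.pow_pos hpos
    have hexp : 2 * (m + 1) - 1 = m + (m + 1) := by omega
    rw [hsize, Fintype.card_option, Fintype.card_prod, Fintype.card_fun, Fintype.card_fun,
      Fintype.card_fin, Fintype.card_fin, Fintype.card_fin, ← pow_add, ← hexp]
    omega

end BDDPaper
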